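/- Let Γ = T_{p_1,…,p_t} be a star-shaped graph and ĩU^Dr the universal ıquantum loop algebra of its simply-laced GCM. Then for every integer a, the ℚ(v)-subalgebra of ĩU^Dr generated by B_{⋆,a}, B_{⋆,a+1}, K_⋆^{±1} and C^{±1} contains B_{⋆,l} for every l ∈ ℤ, and contains Θ_{⋆,m} and H_{⋆,m} for every m ≥ 1. -/

import Mathlib

noncomputable section

/-- The base field `ℚ(v)` of rational functions in `v` over `ℚ`. -/
abbrev Kv : Type := RatFunc ℚ

/-- The element `v` of `ℚ(v)`. -/
def vv : Kv := RatFunc.X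

/-- The quantum integer `[r] = (v^r - v^{-r})/(v - v⁻¹)`. -/
def qint (r : ℤ) : Kv := (vv ^ r - vv ^ (-r)) / (vv - vv⁻¹)

/-- Generators of the universal ıquantum loop algebra: `K_μ^{±1}`, `C^{±1}`,
`H_{μ,m}` (`m ≥ 1`, where `Gen.H μ n` stands for `H_{μ,n+1}`) and `B_{μ,l}` (`l ∈ ℤ`). -/
inductive Gen (I : Type) : Type
  | K : I → Gen I
  | Kinv : I → Gen I
  | C : Gen I
  | Cinv : Gen I
  | H : I → ℕ → Gen I
  | B : I → ℤ → Gen I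

/-- The free algebra over `ℚ(v)` on the generators. -/
abbrev FA (I : Type) : Type := FreeAlgebra Kv (Gen I)

variable {I : Type}

/-- `K_μ` -/
def gK (μ : I) : FA I := FreeAlgebra.ι Kv (Gen.K μ)

/-- `K_μ⁻¹` -/
def gKinv (μ : I) : FA I := FreeAlgebra.ι Kv (Gen.Kinv μ)

/-- `C` -/
def gC : FA I := FreeAlgebra.ι Kv Gen.C

/-- `C⁻¹` -/
def gCinv : FA I := FreeAlgebra.ι Kv Gen.Cinv

/-- `H_{μ,m}` for `m ≥ 1`. -/
def gH (μ : I) (m : ℕ) : FA I := FreeAlgebra.ι Kv (Gen.H μ (m - 1))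

/-- `B_{μ,l}`. -/
def gB (μ : I) (l : ℤ) : FA I := FreeAlgebra.ι Kv (Gen.B μ l)

/-- `C^k` for `k : ℤ`, using the formal inverse generator for negative exponents. -/
def gCpow (k : ℤ) : FA I := if 0 ≤ k then gC ^ k.toNat else gCinv ^ (-k).toNat

/-- `Θ_{μ,m}`: zero for `m < 0`, `(v-v⁻¹)⁻¹` for `m = 0`, and for `m ≥ 1` the
expression `Σ_{k=1}^m ((v-v⁻¹)^{k-1}/k!) Σ_{m₁+⋯+m_k=m, m_j ≥ 1} H_{μ,m₁}⋯H_{μ,m_k}`. -/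
def gTheta (μ : I) (m : ℤ) : FA I :=
  if m < 0 then 0
  else if m = 0 then (vv - vv⁻¹)⁻¹ • (1 : FA I)
  else ∑ k ∈ Finset.Icc 1 m.toNat,
    ((vv - vv⁻¹) ^ (k - 1) / (Nat.factorial k : Kv)) •
      ∑ c ∈ (Finset.Nat.antidiagonalTuple k m.toNat).filter (fun c => ∀ i, 0 < c i),
        (List.ofFn fun i : Fin k => gH μ (c i)).prod

/-- `[a,b]_u = ab - u·ba`. -/
def brk (a b : FA I) (u : Kv) : FA I := a * b - u • (b * a)

/-- `S(k₁,k₂|l;μ,ν)`. -/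
def Sterm (μ ν : I) (k1 k2 l : ℤ) : FA I :=
  gB μ k1 * gB μ k2 * gB ν l - qint 2 • (gB μ k1 * gB ν l * gB μ k2) +
    gB ν l * gB μ k1 * gB μ k2

/-- `𝕊(k₁,k₂|l;μ,ν)`: symmetrization of `S` in `k₁,k₂` (no doubling when `k₁ = k₂`). -/
def Ssym (μ ν : I) (k1 k2 l : ℤ) : FA I :=
  if k1 = k2 then Sterm μ ν k1 k2 l else Sterm μ ν k1 k2 l + Sterm μ ν k2 k1 l

/-- `R(k₁,k₂|l;μ,ν)`.  The sums over `p ≥ 0` (resp. `p ≥ 1`) are finite since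
`Θ_{μ,m} = 0` for `m < 0`; the chosen ranges contain all indices giving a nonzero term. -/
def Rterm (μ ν : I) (k1 k2 l : ℤ) : FA I :=
  gK μ * gCpow k1 *
    (-(∑ p ∈ Finset.range ((k2 - k1).toNat + 1),
        (vv ^ (2 * p) * qint 2) •
          (brk (gTheta μ (k2 - k1 - 2 * p - 1)) (gB ν (l - 1)) (vv ^ (-2 : ℤ)) *
            gC ^ (p + 1)))
      - (∑ p ∈ Finset.Icc 1 (k2 - k1).toNat,
          (vv ^ (2 * p - 1) * qint 2) •
            (brk (gB ν l) (gTheta μ (k2 - k1 - 2 * p)) (vv ^ (-2 : ℤ)) * gC ^ p))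
      - brk (gB ν l) (gTheta μ (k2 - k1)) (vv ^ (-2 : ℤ)))

/-- `ℝ(k₁,k₂|l;μ,ν)`: symmetrization of `R` in `k₁,k₂` (no doubling when `k₁ = k₂`). -/
def Rsym (μ ν : I) (k1 k2 l : ℤ) : FA I :=
  if k1 = k2 then Rterm μ ν k1 k2 l else Rterm μ ν k1 k2 l + Rterm μ ν k2 k1 l

/-- The defining relations of the universal ıquantum loop algebra attached to a
simply-laced GCM `c`. -/
inductive IQLArel (c : I → I → ℤ) : FA I → FA I → Prop
  | KKinv (μ : I) : IQLArel c (gK μ * gKinv μ) 1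
  | KinvK (μ : I) : IQLArel c (gKinv μ * gK μ) 1
  | CCinv : IQLArel c (gC * gCinv) 1
  | CinvC : IQLArel c (gCinv * gC) 1
  | Kcentral (μ : I) (x : FA I) : IQLArel c (gK μ * x) (x * gK μ)
  | Kinvcentral (μ : I) (x : FA I) : IQLArel c (gKinv μ * x) (x * gKinv μ)
  | Ccentral (x : FA I) : IQLArel c (gC * x) (x * gC)
  | Cinvcentral (x : FA I) : IQLArel c (gCinv * x) (x * gCinv)
  | HH (μ ν : I) (m n : ℕ) (hm : 1 ≤ m) (hn : 1 ≤ n) :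
      IQLArel c (gH μ m * gH ν n) (gH ν n * gH μ m)
  | HB (μ ν : I) (m : ℕ) (hm : 1 ≤ m) (l : ℤ) :
      IQLArel c (gH μ m * gB ν l - gB ν l * gH μ m)
        ((qint (m * c μ ν) / (m : Kv)) • gB ν (l + m) -
          (qint (m * c μ ν) / (m : Kv)) • (gB ν (l - m) * gC ^ m))
  | BBzero (μ ν : I) (h : c μ ν = 0) (k l : ℤ) :
      IQLArel c (gB μ k * gB ν l) (gB ν l * gB μ k)
  | BBne (μ ν : I) (h : μ ≠ ν) (k l : ℤ) :
      IQLArel c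
        (brk (gB μ k) (gB ν (l + 1)) (vv ^ (-c μ ν)) -
          vv ^ (-c μ ν) • brk (gB μ (k + 1)) (gB ν l) (vv ^ (c μ ν))) 0
  | BBsame (μ : I) (k l : ℤ) :
      IQLArel c
        (brk (gB μ k) (gB μ (l + 1)) (vv ^ (-2 : ℤ)) -
          vv ^ (-2 : ℤ) • brk (gB μ (k + 1)) (gB μ l) (vv ^ (2 : ℤ)))
        (vv ^ (-2 : ℤ) • (gTheta μ (l - k + 1) * gCpow k * gK μ) -
          vv ^ (-4 : ℤ) • (gTheta μ (l - k - 1) * gCpow (k + 1) * gK μ) +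
          vv ^ (-2 : ℤ) • (gTheta μ (k - l + 1) * gCpow l * gK μ) -
          vv ^ (-4 : ℤ) • (gTheta μ (k - l - 1) * gCpow (l + 1) * gK μ))
  | serre (μ ν : I) (h : c μ ν = -1) (k1 k2 l : ℤ) :
      IQLArel c (Ssym μ ν k1 k2 l) (Rsym μ ν k1 k2 l)

/-- The universal ıquantum loop algebra `ĩU^Dr` attached to the GCM `c`. -/
abbrev UiDr (c : I → I → ℤ) : Type := RingQuot (IQLArel c)

/-- The canonical projection from the free algebra to `ĩU^Dr`. -/
def toUiDr (c : I → I → ℤ) : FA I →ₐ[Kv] UiDr c := RingQuot.mkAlgHom Kv (IQLArel c)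

/-- Vertices of the star-shaped graph `T_{p₁,…,p_t}`: the star point `none = ⋆` and the
branch vertices `some ⟨i,j⟩ = [i, j+1]` for `1 ≤ i ≤ t`, `1 ≤ j+1 ≤ p_i - 1`. -/
abbrev StarVertex (t : ℕ) (p : Fin t → ℕ) : Type := Option ((i : Fin t) × Fin (p i - 1))

/-- The simply-laced generalized Cartan matrix of the star-shaped graph
`T_{p₁,…,p_t}`: `c_{μν} = -1` for adjacent vertices, `0` for non-adjacent distinct
vertices and `2` on the diagonal. -/
def starCartan (t : ℕ) (p : Fin t → ℕ) : StarVertex t p → StarVertex t p → ℤ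
  | none, none => 2
  | none, some ⟨_, j⟩ => if (j : ℕ) = 0 then -1 else 0
  | some ⟨_, j⟩, none => if (j : ℕ) = 0 then -1 else 0
  | some ⟨i, j⟩, some ⟨i', j'⟩ =>
      if i.val = i'.val then
        if (j : ℕ) = (j' : ℕ) then 2
        else if (j : ℕ) + 1 = (j' : ℕ) ∨ (j' : ℕ) + 1 = (j : ℕ) then -1 else 0
      else 0


/-- The generating set `{B_{⋆,a}, B_{⋆,a+1}, K_⋆^{±1}, C^{±1}}` in `ĩU^Dr`. -/
def starGenSet (t : ℕ) (p : Fin t → ℕ) (a : ℤ) : Set (UiDr (starCartan t p)) :=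
  {toUiDr (starCartan t p) (gB none a), toUiDr (starCartan t p) (gB none (a + 1)),
   toUiDr (starCartan t p) (gK none), toUiDr (starCartan t p) (gKinv none),
   toUiDr (starCartan t p) gC, toUiDr (starCartan t p) gCinv}

theorem vv_pow_ne_one {n : ℕ} (hn : n ≠ 0) : vv ^ n ≠ 1 := by
  intro h
  have hX : (Polynomial.X : Polynomial ℚ) ^ n = 1 := by
    apply RatFunc.algebraMap_injective ℚ
    simpa [vv, RatFunc.algebraMap_X] using h
  have hdeg := congrArg Polynomial.natDegree hX
  simp at hdeg
  exact hn hdeg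

theorem vv_ne_zero : vv ≠ 0 := RatFunc.X_ne_zero

theorem vv_sub_inv_ne_zero : vv - vv⁻¹ ≠ 0 := by
  intro h
  apply vv_pow_ne_one two_ne_zero
  have := vv_ne_zero
  field_simp at h
  linear_combination h

theorem qint_two_ne_zero : qint 2 ≠ 0 := by
  refine div_ne_zero (fun h => vv_pow_ne_one four_ne_zero ?_) vv_sub_inv_ne_zero
  have hv := vv_ne_zero
  rw [zpow_neg, show vv ^ (2 : ℤ) = vv ^ 2 from zpow_ofNat vv 2] at h
  field_simp at h
  linear_combination h

/-- `Θ_{μ,m} - H_{μ,m}` is a polynomial in the `H_{μ,j}` with `1 ≤ j < m`. -/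
theorem gTheta_sub_gH_mem (T : Subalgebra Kv (FA I)) (μ : I) {m : ℕ} (hm : 1 ≤ m)
    (hT : ∀ j, 1 ≤ j → j < m → gH μ j ∈ T) : gTheta μ (m : ℤ) - gH μ m ∈ T := by
  have hIcc : Finset.Icc 1 m = insert 1 (Finset.Icc 2 m) := by
    ext k; simp only [Finset.mem_Icc, Finset.mem_insert]; omega
  have hfilter : ({![m]} : Finset (Fin 1 → ℕ)).filter (fun c => ∀ i, 0 < c i) = {![m]} := by
    ext c
    simp only [Finset.mem_filter, Finset.mem_singleton, and_iff_left_iff_imp]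
    rintro rfl i
    simpa using Nat.pos_of_ne_zero (by omega)
  rw [gTheta, if_neg (by omega), if_neg (by omega), Int.toNat_natCast, hIcc,
    Finset.sum_insert (by simp), Finset.Nat.antidiagonalTuple_one, hfilter]
  simp only [Finset.sum_singleton, Nat.sub_self, pow_zero, Nat.factorial_one, Nat.cast_one,
    div_one, one_smul, List.ofFn_succ, List.ofFn_zero, List.prod_singleton,
    Matrix.cons_val_zero, add_sub_cancel_left]
  refine T.sum_mem fun k hk => T.smul_mem (T.sum_mem fun c hc => T.list_prod_mem ?_) _
  rw [Finset.mem_filter, Finset.Nat.mem_antidiagonalTuple] at hc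
  obtain ⟨hsum, hpos⟩ := hc
  intro x hx
  obtain ⟨i, rfl⟩ := List.mem_ofFn.mp hx
  refine hT _ (hpos i) ?_
  have hk2 : 2 ≤ k := (Finset.mem_Icc.mp hk).1
  obtain ⟨j, hij⟩ : ∃ j : Fin k, j ≠ i :=
    have : Nontrivial (Fin k) := Fin.nontrivial_iff_two_le.mpr hk2
    exists_ne i
  have hle : ∑ x ∈ {i, j}, c x ≤ ∑ x, c x :=
    Finset.sum_le_sum_of_subset (Finset.subset_univ _)
  rw [Finset.sum_pair hij.symm, hsum] at hle
  have := hpos j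
  omega

theorem toUiDr_eq_of_rel {c : I → I → ℤ} {x y : FA I} (h : IQLArel c x y) :
    toUiDr c x = toUiDr c y :=
  RingQuot.mkAlgHom_rel Kv h

theorem toUiDr_gCpow_mul_neg (c : I → I → ℤ) (k : ℤ) :
    toUiDr c (gCpow k) * toUiDr c (gCpow (-k)) = 1 := by
  have h₁ : toUiDr c gC * toUiDr c gCinv = 1 := by
    simpa using toUiDr_eq_of_rel (IQLArel.CCinv (c := c))
  have h₂ : toUiDr c gCinv * toUiDr c gC = 1 := by
    simpa using toUiDr_eq_of_rel (IQLArel.CinvC (c := c))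
  have hc : Commute (toUiDr c gC) (toUiDr c gCinv) := h₁.trans h₂.symm
  rcases lt_trichotomy k 0 with hk | rfl | hk
  · rw [gCpow, gCpow, if_neg (by omega), if_pos (by omega), map_pow, map_pow,
      ← hc.symm.mul_pow, h₂, one_pow]
  · simp [gCpow]
  · rw [gCpow, gCpow, if_pos (by omega), if_neg (by omega), map_pow, map_pow, neg_neg,
      ← hc.mul_pow, h₁, one_pow]

section Generation

variable {c : I → I → ℤ} {μ : I} {S : Subalgebra Kv (UiDr c)}

theorem toUiDr_gCpow_mem (hC : toUiDr c gC ∈ S) (hC' : toUiDr c gCinv ∈ S) (k : ℤ) :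
    toUiDr c (gCpow k) ∈ S := by
  rw [gCpow]
  split_ifs
  · rw [map_pow]; exact S.pow_mem hC _
  · rw [map_pow]; exact S.pow_mem hC' _

theorem mem_of_mul_gCpow_mul_gK_mem (hC : toUiDr c gC ∈ S) (hC' : toUiDr c gCinv ∈ S)
    (hK' : toUiDr c (gKinv μ) ∈ S) {x : UiDr c} {k : ℤ}
    (h : x * toUiDr c (gCpow k) * toUiDr c (gK μ) ∈ S) : x ∈ S := by
  have hKK : toUiDr c (gK μ) * toUiDr c (gKinv μ) = 1 := by
    simpa using toUiDr_eq_of_rel (IQLArel.KKinv (c := c) μ)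
  have := S.mul_mem (S.mul_mem h hK') (toUiDr_gCpow_mem hC hC' (-k))
  rwa [mul_assoc _ _ (toUiDr c (gKinv μ)), hKK, mul_one, mul_assoc, toUiDr_gCpow_mul_neg,
    mul_one] at this

theorem toUiDr_gTheta_mem_of_nonpos {m : ℤ} (hm : m ≤ 0) : toUiDr c (gTheta μ m) ∈ S := by
  rcases hm.lt_or_eq with h | rfl
  · rw [gTheta, if_pos h, map_zero]; exact S.zero_mem
  · rw [gTheta, if_neg (lt_irrefl _), if_pos rfl, map_smul, map_one]
    exact S.smul_mem S.one_mem _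

/-- The quadratic relation between the `B_{μ,l}` expresses `Θ_{μ,n+1}` through
`B_{μ,k}, B_{μ,k+1}, B_{μ,k+n}, B_{μ,k+n+1}` and `Θ_{μ,n-1}`. -/
theorem toUiDr_gTheta_succ_mem (hC : toUiDr c gC ∈ S) (hC' : toUiDr c gCinv ∈ S)
    (hK : toUiDr c (gK μ) ∈ S) (hK' : toUiDr c (gKinv μ) ∈ S) {k : ℤ} {n : ℕ}
    (h₁ : toUiDr c (gB μ k) ∈ S) (h₂ : toUiDr c (gB μ (k + 1)) ∈ S)
    (h₃ : toUiDr c (gB μ (k + n)) ∈ S) (h₄ : toUiDr c (gB μ (k + n + 1)) ∈ S)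
    (hΘ : toUiDr c (gTheta μ (n - 1)) ∈ S) : toUiDr c (gTheta μ (n + 1)) ∈ S := by
  have hrel := toUiDr_eq_of_rel (IQLArel.BBsame (c := c) μ k (k + n))
  have hlhs : toUiDr c (brk (gB μ k) (gB μ (k + n + 1)) (vv ^ (-2 : ℤ)) -
      vv ^ (-2 : ℤ) • brk (gB μ (k + 1)) (gB μ (k + n)) (vv ^ (2 : ℤ))) ∈ S := by
    simp only [brk, map_sub, map_smul, map_mul]
    exact S.sub_mem (S.sub_mem (S.mul_mem h₁ h₄) (S.smul_mem (S.mul_mem h₄ h₁) _))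
      (S.smul_mem (S.sub_mem (S.mul_mem h₂ h₃) (S.smul_mem (S.mul_mem h₃ h₂) _)) _)
  rw [hrel] at hlhs
  simp only [map_sub, map_add, map_smul, map_mul] at hlhs
  have hmem : ∀ (m j : ℤ) (u : Kv), toUiDr c (gTheta μ m) ∈ S →
      u • (toUiDr c (gTheta μ m) * toUiDr c (gCpow j) * toUiDr c (gK μ)) ∈ S :=
    fun m j u h => S.smul_mem (S.mul_mem (S.mul_mem h (toUiDr_gCpow_mem hC hC' j)) hK) u
  rw [show k + (n : ℤ) - k + 1 = n + 1 by ring, show k + (n : ℤ) - k - 1 = n - 1 by ring] at hlhs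
  have hlhs := S.add_mem hlhs
    (hmem (k - (k + n) - 1) (k + n + 1) (vv ^ (-4 : ℤ))
      (toUiDr_gTheta_mem_of_nonpos (by omega)))
  rw [sub_add_cancel] at hlhs
  have hv : vv ^ (-2 : ℤ) ≠ 0 := zpow_ne_zero _ vv_ne_zero
  have hdiv : ∀ (u : Kv) (x : UiDr c), u ≠ 0 → u • x ∈ S → x ∈ S := fun u x hu hx => by
    simpa [smul_smul, inv_mul_cancel₀ hu] using S.smul_mem hx u⁻¹
  refine mem_of_mul_gCpow_mul_gK_mem (k := k) hC hC' hK' ?_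
  have hrest := hmem (n - 1) (k + 1) (vv ^ (-4 : ℤ)) hΘ
  rcases Nat.eq_zero_or_pos n with rfl | hn
  · refine hdiv (vv ^ (-2 : ℤ) + vv ^ (-2 : ℤ)) _ ?_ ?_
    · rw [← two_mul]; exact mul_ne_zero two_ne_zero hv
    · have := S.add_mem hlhs hrest
      rw [add_smul]
      simp only [Nat.cast_zero, add_zero, sub_self] at this ⊢
      convert this using 1
      abel
  · refine hdiv _ _ hv ?_
    have := S.sub_mem (S.add_mem hlhs hrest) (hmem (k - (k + n) + 1) (k + n) (vv ^ (-2 : ℤ))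
      (toUiDr_gTheta_mem_of_nonpos (by omega)))
    convert this using 1
    abel

theorem toUiDr_gH_mem (hΘ : ∀ m : ℕ, 1 ≤ m → toUiDr c (gTheta μ m) ∈ S) (m : ℕ) (hm : 1 ≤ m) :
    toUiDr c (gH μ m) ∈ S := by
  induction m using Nat.strong_induction_on with
  | _ m ih =>
    have := gTheta_sub_gH_mem (S.comap (toUiDr c)) μ hm fun j hj hjm => ih j hjm hj
    rw [Subalgebra.mem_comap, map_sub] at this
    simpa using S.sub_mem (hΘ m hm) this

theorem toUiDr_gH_one_commutator (hμ : c μ μ = 2) (l : ℤ) :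
    toUiDr c (gH μ 1) * toUiDr c (gB μ l) - toUiDr c (gB μ l) * toUiDr c (gH μ 1) =
      qint 2 • (toUiDr c (gB μ (l + 1)) - toUiDr c (gB μ (l - 1)) * toUiDr c gC) := by
  have h := toUiDr_eq_of_rel (IQLArel.HB (c := c) μ μ 1 le_rfl l)
  simpa [hμ, smul_sub] using h

theorem toUiDr_gB_mem (hμ : c μ μ = 2) (hC : toUiDr c gC ∈ S) (hC' : toUiDr c gCinv ∈ S)
    (hH : toUiDr c (gH μ 1) ∈ S) {a : ℤ} (h₀ : toUiDr c (gB μ a) ∈ S)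
    (h₁ : toUiDr c (gB μ (a + 1)) ∈ S) (l : ℤ) : toUiDr c (gB μ l) ∈ S := by
  have hstep : ∀ l, toUiDr c (gB μ l) ∈ S →
      toUiDr c (gB μ (l + 1)) - toUiDr c (gB μ (l - 1)) * toUiDr c gC ∈ S := fun l hl => by
    have := S.smul_mem (S.sub_mem (S.mul_mem hH hl) (S.mul_mem hl hH)) (qint 2)⁻¹
    rwa [toUiDr_gH_one_commutator hμ, smul_smul, inv_mul_cancel₀ qint_two_ne_zero,
      one_smul] at this
  have hCC : toUiDr c gC * toUiDr c gCinv = 1 := by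
    simpa using toUiDr_eq_of_rel (IQLArel.CCinv (c := c))
  suffices h : ∀ l, toUiDr c (gB μ l) ∈ S ∧ toUiDr c (gB μ (l + 1)) ∈ S from (h l).1
  intro l
  induction l using Int.inductionOn' (b := a) with
  | zero => exact ⟨h₀, h₁⟩
  | succ k _ ih =>
    refine ⟨ih.2, ?_⟩
    have := S.add_mem (hstep _ ih.2) (S.mul_mem ih.1 hC)
    simpa using this
  | pred k _ ih =>
    refine ⟨?_, by simpa using ih.1⟩
    have := S.mul_mem (S.sub_mem ih.2 (hstep _ ih.1)) hC'
    rwa [sub_sub_cancel, mul_assoc, hCC, mul_one] at this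

/-- A subalgebra containing `B_{μ,a}`, `B_{μ,a+1}`, `K_μ^{±1}` and `C^{±1}` contains all
`B_{μ,l}`, `Θ_{μ,m}` and `H_{μ,m}`. -/
theorem generation_of_two_consecutive (hμ : c μ μ = 2) (hC : toUiDr c gC ∈ S)
    (hC' : toUiDr c gCinv ∈ S) (hK : toUiDr c (gK μ) ∈ S) (hK' : toUiDr c (gKinv μ) ∈ S)
    {a : ℤ} (h₀ : toUiDr c (gB μ a) ∈ S) (h₁ : toUiDr c (gB μ (a + 1)) ∈ S) :
    (∀ l : ℤ, toUiDr c (gB μ l) ∈ S) ∧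
      ∀ m : ℕ, 1 ≤ m → toUiDr c (gTheta μ (m : ℤ)) ∈ S ∧ toUiDr c (gH μ m) ∈ S := by
  have hΘ₁ : toUiDr c (gTheta μ (1 : ℕ)) ∈ S := by
    simpa using toUiDr_gTheta_succ_mem (n := 0) hC hC' hK hK' h₀ h₁ (by simpa using h₀)
      (by simpa using h₁) (toUiDr_gTheta_mem_of_nonpos (by norm_num))
  have hH₁ : toUiDr c (gH μ 1) ∈ S := by
    have := gTheta_sub_gH_mem (S.comap (toUiDr c)) μ le_rfl (by omega)
    rw [Subalgebra.mem_comap, map_sub] at this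
    simpa using S.sub_mem hΘ₁ this
  have hB := toUiDr_gB_mem hμ hC hC' hH₁ h₀ h₁
  have hΘ : ∀ m : ℕ, toUiDr c (gTheta μ m) ∈ S := by
    intro m
    induction m using Nat.strong_induction_on with
    | _ m ih =>
      rcases m with _ | n
      · exact toUiDr_gTheta_mem_of_nonpos (by simp)
      · rw [Nat.cast_succ]
        refine toUiDr_gTheta_succ_mem (k := 0) hC hC' hK hK' (hB _) (hB _) (hB _) (hB _) ?_
        rcases n with _ | j
        · exact toUiDr_gTheta_mem_of_nonpos (by simp)
        · simpa using ih j (by omega)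
  exact ⟨hB, fun m hm => ⟨hΘ m, toUiDr_gH_mem (fun j _ => hΘ j) m hm⟩⟩

end Generation

/-- For any `a ∈ ℤ`, the `ℚ(v)`-subalgebra of `ĩU^Dr` generated by `B_{⋆,a}`,
`B_{⋆,a+1}`, `K_⋆^{±1}` and `C^{±1}` contains `B_{⋆,l}` for every `l ∈ ℤ`, and
contains `Θ_{⋆,m}` and `H_{⋆,m}` for every `m ≥ 1`. -/
theorem UiDr_star_generation (t : ℕ) (ht : 1 ≤ t) (p : Fin t → ℕ)
    (hp : ∀ i, 1 ≤ p i) (a : ℤ) :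
    (∀ l : ℤ,
      toUiDr (starCartan t p) (gB none l) ∈ Algebra.adjoin Kv (starGenSet t p a)) ∧
    (∀ m : ℕ, 1 ≤ m →
      toUiDr (starCartan t p) (gTheta none (m : ℤ)) ∈
        Algebra.adjoin Kv (starGenSet t p a) ∧
      toUiDr (starCartan t p) (gH none m) ∈ Algebra.adjoin Kv (starGenSet t p a)) := by
  have hmem : ∀ x ∈ starGenSet t p a, x ∈ Algebra.adjoin Kv (starGenSet t p a) :=
    fun x hx => Algebra.subset_adjoin hx
  refine generation_of_two_consecutive rfl ?_ ?_ ?_ ?_ (a := a) ?_ ?_ <;>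
    exact hmem _ (by simp [starGenSet])

end
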